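/- Let U_s be a shear flow, α > 0, and c ∈ ℂ with inf_{y≥0}|U_s(y) − c| > 0. Then there exist smooth functions φ^{*,−}, φ^{*,+} : [0,∞) → ℂ satisfying Ray*_c φ^{*,±} = 0 on [0,∞) such that for every n ∈ ℕ there are nonzero constants C_n^± ∈ ℂ with e^{∓αy}·(φ^{*,±})^{(n)}(y) → C_n^± as y → ∞ (i.e. the n-th derivative of φ^{*,−} is asymptotic to C_n^− e^{−αy} and that of φ^{*,+} is asymptotic to C_n^+ e^{αy}). -/

import Mathlib

open MeasureTheory Filter Set

noncomputable section

/-- `Δ_α φ = φ'' − α² φ`. -/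
def DeltaA (α : ℝ) (φ : ℝ → ℂ) : ℝ → ℂ :=
  fun y => deriv (deriv φ) y - (α : ℂ) ^ 2 * φ y

/-- The Rayleigh operator `Ray_c φ = (U − c) Δ_α φ − U'' φ`. -/
def Ray (U : ℝ → ℝ) (α : ℝ) (c : ℂ) (φ : ℝ → ℂ) : ℝ → ℂ :=
  fun y => ((U y : ℂ) - c) * DeltaA α φ y - ((deriv (deriv U) y : ℝ) : ℂ) * φ y

/-- The adjoint Rayleigh operator `Ray*_c φ = (U − conj c) Δ_α φ + 2 U' φ'`. -/
def RayStar (U : ℝ → ℝ) (α : ℝ) (c : ℂ) (φ : ℝ → ℂ) : ℝ → ℂ :=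
  fun y => ((U y : ℂ) - (starRingEnd ℂ) c) * DeltaA α φ y + 2 * ((deriv U y : ℝ) : ℂ) * deriv φ y

/-- A shear flow with decay rate `η₀`: smooth, bounded, vanishing at the origin with its
first two derivatives, with a finite limit at `+∞` and exponentially decaying derivatives. -/
def ShearFlow (U : ℝ → ℝ) (η₀ : ℝ) : Prop :=
  ContDiff ℝ (⊤ : ℕ∞) U ∧ (∃ M : ℝ, ∀ y : ℝ, |U y| ≤ M) ∧ U 0 = 0 ∧ deriv U 0 = 0 ∧
    deriv (deriv U) 0 = 0 ∧ (∃ L : ℝ, Tendsto U atTop (nhds L)) ∧ 0 < η₀ ∧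
    (∀ k : ℕ, 1 ≤ k → ∃ C : ℝ, 0 < C ∧ ∀ y : ℝ, 0 ≤ y →
      |iteratedDeriv k U y| ≤ C * Real.exp (-η₀ * y))


open scoped BoundedContinuousFunction in
theorem fix_lemma (ω : ℝ → ℝ) (hωc : Continuous ω) (hω : ∀ y, 0 < ω y) (g : ℝ → ℂ)
    (hg : Continuous g) (A : ℝ) (hA : ∀ y, ‖g y‖ ≤ A * ω y) (L : (ℝ → ℂ) → ℝ → ℂ)
    (hLc : ∀ (ψ : ℝ → ℂ) (C : ℝ), Continuous ψ → (∀ y, ‖ψ y‖ ≤ C * ω y) → Continuous (L ψ))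
    (hLb : ∀ (ψ : ℝ → ℂ) (C : ℝ), Continuous ψ → (∀ y, ‖ψ y‖ ≤ C * ω y) →
      ∀ y, ‖L ψ y‖ ≤ C / 2 * ω y)
    (hLs : ∀ (ψ₁ ψ₂ : ℝ → ℂ) (C₁ C₂ : ℝ), Continuous ψ₁ → (∀ y, ‖ψ₁ y‖ ≤ C₁ * ω y) →
      Continuous ψ₂ → (∀ y, ‖ψ₂ y‖ ≤ C₂ * ω y) →
      ∀ y, L (fun s => ψ₁ s - ψ₂ s) y = L ψ₁ y - L ψ₂ y) :
    ∃ ψ : ℝ → ℂ, Continuous ψ ∧ (∀ y, ‖ψ y‖ ≤ 2 * A * ω y) ∧ ∀ y, ψ y = g y + L ψ y := by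
  have hωne : ∀ y, (ω y : ℂ) ≠ 0 := fun y => by exact_mod_cast (hω y).ne'
  have hωcc : Continuous (fun y => (ω y : ℂ)) := by fun_prop
  have hA0 : 0 ≤ A := by
    have h := (norm_nonneg _).trans (hA 0)
    exact nonneg_of_mul_nonneg_left h (hω 0)
  let W : (ℝ →ᵇ ℂ) → ℝ → ℂ := fun f y => (ω y : ℂ) * f y
  have hWc : ∀ f, Continuous (W f) := fun f => hωcc.mul f.continuous
  have hWb : ∀ f y, ‖W f y‖ ≤ ‖f‖ * ω y := by
    intro f y
    simp only [W, norm_mul, Complex.norm_real, Real.norm_eq_abs, abs_of_pos (hω y)]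
    rw [mul_comm]
    exact mul_le_mul_of_nonneg_right (f.norm_coe_le_norm y) (hω y).le
  have hTb : ∀ f y, ‖(g y + L (W f) y) / (ω y : ℂ)‖ ≤ A + ‖f‖ / 2 := by
    intro f y
    rw [norm_div, Complex.norm_real, Real.norm_eq_abs, abs_of_pos (hω y), div_le_iff₀ (hω y)]
    refine (norm_add_le _ _).trans ?_
    have := hLb _ _ (hWc f) (hWb f) y
    linarith [hA y]
  let T : (ℝ →ᵇ ℂ) → (ℝ →ᵇ ℂ) := fun f =>
    BoundedContinuousFunction.ofNormedAddCommGroup (fun y => (g y + L (W f) y) / (ω y : ℂ))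
      ((hg.add (hLc _ _ (hWc f) (hWb f))).div hωcc hωne) (A + ‖f‖ / 2) (hTb f)
  have hT : ContractingWith (1/2) T := by
    refine ⟨by
      rw [← NNReal.coe_lt_coe]; norm_num, LipschitzWith.of_dist_le_mul ?_⟩
    intro f h
    rw [dist_eq_norm, dist_eq_norm, BoundedContinuousFunction.norm_le (by positivity)]
    intro y
    have e1 : (T f - T h) y = L (W (f - h)) y / (ω y : ℂ) := by
      have : L (W (f - h)) y = L (W f) y - L (W h) y := by
        rw [← hLs _ _ _ _ (hWc f) (hWb f) (hWc h) (hWb h)]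
        congr 1
        funext s
        simp [W]; ring
      rw [this]
      simp [T]; ring
    rw [e1, norm_div, Complex.norm_real, Real.norm_eq_abs, abs_of_pos (hω y), div_le_iff₀ (hω y)]
    refine (hLb _ _ (hWc _) (hWb _) y).trans (le_of_eq ?_)
    push_cast; ring
  set f := ContractingWith.fixedPoint T hT with hf
  have hfix : T f = f := hT.fixedPoint_isFixedPt
  have hv : ∀ y, (g y + L (W f) y) / (ω y : ℂ) = f y := fun y => by
    conv_rhs => rw [← hfix]
    rfl
  have hn : ‖f‖ ≤ 2 * A := by
    have : ‖f‖ ≤ A + ‖f‖ / 2 := by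
      rw [BoundedContinuousFunction.norm_le (by positivity)]
      intro y
      rw [← hv y]; exact hTb f y
    linarith
  refine ⟨W f, hWc f, fun y => (hWb f y).trans (mul_le_mul_of_nonneg_right hn (hω y).le), ?_⟩
  intro y
  have := hv y
  rw [div_eq_iff (hωne y)] at this
  rw [this]; simp only [W]; ring

theorem smooth_of_system (α : ℝ) (p φ ψ : ℝ → ℂ) (hp : ContDiff ℝ (⊤ : ℕ∞) p)
    (h1 : ∀ y, HasDerivAt φ (ψ y) y) (h2 : ∀ y, HasDerivAt ψ ((α : ℂ) ^ 2 * φ y - p y * ψ y) y) :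
    ContDiff ℝ (⊤ : ℕ∞) φ ∧ ContDiff ℝ (⊤ : ℕ∞) ψ := by
  have key : ∀ n : ℕ, ContDiff ℝ n φ ∧ ContDiff ℝ n ψ := by
    intro n
    induction n with
    | zero =>
      have a : Continuous φ := continuous_iff_continuousAt.2 fun y => (h1 y).continuousAt
      have b : Continuous ψ := continuous_iff_continuousAt.2 fun y => (h2 y).continuousAt
      exact ⟨contDiff_zero.2 a, contDiff_zero.2 b⟩
    | succ n ih =>
      have hpn : ContDiff ℝ n p := hp.of_le (by exact_mod_cast le_top)
      have d1 : deriv φ = ψ := funext fun y => (h1 y).deriv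
      have d2 : deriv ψ = fun y => (α : ℂ) ^ 2 * φ y - p y * ψ y := funext fun y => (h2 y).deriv
      push_cast
      rw [contDiff_succ_iff_deriv, contDiff_succ_iff_deriv, d1, d2]
      refine ⟨⟨fun y => (h1 y).differentiableAt, by simp, ih.2⟩,
        fun y => (h2 y).differentiableAt, by simp, ?_⟩
      exact (contDiff_const.mul ih.1).sub (hpn.mul ih.2)
  exact ⟨contDiff_infty.2 fun n => (key n).1, contDiff_infty.2 fun n => (key n).2⟩

theorem asymp_all (α σ : ℝ) (hσ : σ ^ 2 = α ^ 2) (p φ ψ : ℝ → ℂ) (hp : ContDiff ℝ (⊤ : ℕ∞) p)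
    (hpd : ∀ k : ℕ, Tendsto (iteratedDeriv k p) atTop (nhds 0))
    (h1 : ∀ y, HasDerivAt φ (ψ y) y) (h2 : ∀ y, HasDerivAt ψ ((α : ℂ) ^ 2 * φ y - p y * ψ y) y)
    (C : ℂ) (l1 : Tendsto (fun y : ℝ => ((Real.exp (-(σ * y)) : ℝ) : ℂ) * φ y) atTop (nhds C))
    (l2 : Tendsto (fun y : ℝ => ((Real.exp (-(σ * y)) : ℝ) : ℂ) * ψ y) atTop (nhds (σ * C)))
    (n : ℕ) :
    Tendsto (fun y : ℝ => ((Real.exp (-(σ * y)) : ℝ) : ℂ) * iteratedDeriv n φ y) atTop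
      (nhds ((σ : ℂ) ^ n * C)) := by
  obtain ⟨s1, s2⟩ := smooth_of_system α p φ ψ hp h1 h2
  have d1 : deriv φ = ψ := funext fun y => (h1 y).deriv
  have d2 : deriv ψ = fun y => (α : ℂ) ^ 2 * φ y - p y * ψ y := funext fun y => (h2 y).deriv
  induction n using Nat.strong_induction_on with
  | _ n ih =>
  match n, ih with
  | 0, _ => simpa using l1
  | 1, _ => simpa [iteratedDeriv_one, d1] using l2
  | n + 2, ih =>
    have e : ∀ y, iteratedDeriv (n + 2) φ y = (α : ℂ) ^ 2 * iteratedDeriv n φ y -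
        ∑ i ∈ Finset.range (n + 1), (n.choose i : ℂ) * iteratedDeriv i p y *
          iteratedDeriv (n - i + 1) φ y := by
      intro y
      have c1 : ContDiffAt ℝ n φ y := (s1.of_le (by exact_mod_cast le_top)).contDiffAt
      have c2 : ContDiffAt ℝ n ψ y := (s2.of_le (by exact_mod_cast le_top)).contDiffAt
      have c3 : ContDiffAt ℝ n p y := (hp.of_le (by exact_mod_cast le_top)).contDiffAt
      rw [iteratedDeriv_succ', iteratedDeriv_succ', d1, d2,
        iteratedDeriv_fun_sub (contDiffAt_const.mul c1) (c3.mul c2),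
        iteratedDeriv_fun_mul c3 c2, iteratedDeriv_const_mul_field]
      congr 1
      refine Finset.sum_congr rfl fun i _ => ?_
      rw [iteratedDeriv_succ', d1]
    have lim : Tendsto (fun y : ℝ => (α : ℂ) ^ 2 * (((Real.exp (-(σ * y)) : ℝ) : ℂ) *
        iteratedDeriv n φ y) - ∑ i ∈ Finset.range (n + 1), (n.choose i : ℂ) * iteratedDeriv i p y *
          (((Real.exp (-(σ * y)) : ℝ) : ℂ) * iteratedDeriv (n - i + 1) φ y)) atTop
        (nhds ((α : ℂ) ^ 2 * ((σ : ℂ) ^ n * C) - ∑ i ∈ Finset.range (n + 1),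
          (n.choose i : ℂ) * 0 * ((σ : ℂ) ^ (n - i + 1) * C))) := by
      refine ((ih n (by omega)).const_mul _).sub (tendsto_finsetSum _ fun i _ => ?_)
      exact ((hpd i).const_mul _).mul (ih (n - i + 1) (by omega))
    have hσ' : (σ : ℂ) ^ 2 = (α : ℂ) ^ 2 := by exact_mod_cast hσ
    convert lim using 2
    · rw [e, mul_sub, Finset.mul_sum]
      congr 1
      · ring
      · exact Finset.sum_congr rfl fun i _ => by ring
    · simp [← hσ']; ring

theorem iter_ofReal (U : ℝ → ℝ) (hU : ContDiff ℝ (⊤ : ℕ∞) U) (k : ℕ) :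
    iteratedDeriv k (fun y => (U y : ℂ)) = fun y => ((iteratedDeriv k U y : ℝ) : ℂ) := by
  induction k with
  | zero => simp
  | succ k ih =>
    rw [iteratedDeriv_succ, ih, iteratedDeriv_succ]
    funext y
    have : DifferentiableAt ℝ (iteratedDeriv k U) y :=
      (hU.differentiable_iteratedDeriv k (by exact_mod_cast WithTop.coe_lt_top _)) y
    exact (this.hasDerivAt.ofReal_comp).deriv

theorem p_deriv_tendsto (q p r : ℝ → ℂ) (hq : ContDiff ℝ (⊤ : ℕ∞) q) (hp : ContDiff ℝ (⊤ : ℕ∞) p)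
    (hqp : ∀ y, q y * p y = r y) (δ : ℝ) (hδ : 0 < δ) (hqδ : ∀ y, 0 ≤ y → δ ≤ ‖q y‖)
    (hqk : ∀ k : ℕ, Tendsto (iteratedDeriv (k + 1) q) atTop (nhds 0))
    (hrk : ∀ k : ℕ, Tendsto (iteratedDeriv k r) atTop (nhds 0)) (k : ℕ) :
    Tendsto (iteratedDeriv k p) atTop (nhds 0) := by
  induction k using Nat.strong_induction_on with
  | _ k ih =>
  have hr : r = fun y => q y * p y := funext fun y => (hqp y).symm
  have e : ∀ y, q y * iteratedDeriv k p y = iteratedDeriv k r y - ∑ i ∈ Finset.range k,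
      (k.choose (i + 1) : ℂ) * iteratedDeriv (i + 1) q y * iteratedDeriv (k - (i + 1)) p y := by
    intro y
    have c1 : ContDiffAt ℝ k q y := (hq.of_le (by exact_mod_cast le_top)).contDiffAt
    have c3 : ContDiffAt ℝ k p y := (hp.of_le (by exact_mod_cast le_top)).contDiffAt
    rw [hr, iteratedDeriv_fun_mul c1 c3, Finset.sum_range_succ']
    simp
  have lim : Tendsto (fun y => q y * iteratedDeriv k p y) atTop (nhds 0) := by
    have : Tendsto (fun y => iteratedDeriv k r y - ∑ i ∈ Finset.range k,
      (k.choose (i + 1) : ℂ) * iteratedDeriv (i + 1) q y * iteratedDeriv (k - (i + 1)) p y) atTop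
      (nhds (0 - ∑ i ∈ Finset.range k, (k.choose (i + 1) : ℂ) * 0 * 0)) := by
      refine (hrk k).sub (tendsto_finsetSum _ fun i hi => ?_)
      have := Finset.mem_range.1 hi
      exact ((hqk i).const_mul _).mul (ih _ (by omega))
    simp only [mul_zero, Finset.sum_const_zero, sub_zero] at this
    exact this.congr fun y => (e y).symm
  rw [tendsto_zero_iff_norm_tendsto_zero] at lim ⊢
  have lim2 := lim.const_mul (1 / δ)
  rw [mul_zero] at lim2
  refine tendsto_of_tendsto_of_tendsto_of_le_of_le' tendsto_const_nhds lim2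
    (Eventually.of_forall fun y => norm_nonneg _) ?_
  filter_upwards [eventually_ge_atTop 0] with y hy
  rw [norm_mul, one_div, ← div_eq_inv_mul, le_div_iff₀ hδ, mul_comm]
  exact mul_le_mul_of_nonneg_right (hqδ y hy) (norm_nonneg _)

theorem hasDerivAt_cexp (σ y : ℝ) :
    HasDerivAt (fun y : ℝ => ((Real.exp (σ * y) : ℝ) : ℂ))
      ((σ : ℂ) * ((Real.exp (σ * y) : ℝ) : ℂ)) y := by
  have h : HasDerivAt (fun y : ℝ => Real.exp (σ * y)) (Real.exp (σ * y) * (σ * 1)) y :=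
    ((hasDerivAt_id y).const_mul σ).exp
  have := h.ofReal_comp
  convert this using 1
  push_cast; ring

theorem system_of_ab (α : ℝ) (hα : 0 < α) (p ψ a b : ℝ → ℂ)
    (ha : ∀ y, HasDerivAt a (-(((Real.exp (-α * y) : ℝ) : ℂ) * (p y * ψ y))) y)
    (hb : ∀ y, HasDerivAt b (-(((Real.exp (α * y) : ℝ) : ℂ) * (p y * ψ y))) y)
    (hψ : ∀ y, ψ y = (((Real.exp (α * y) : ℝ) : ℂ) * a y + ((Real.exp (-α * y) : ℝ) : ℂ) * b y) / 2) :
    ∃ φ : ℝ → ℂ, (∀ y, φ y = (((Real.exp (α * y) : ℝ) : ℂ) * a y -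
        ((Real.exp (-α * y) : ℝ) : ℂ) * b y) / (2 * α)) ∧
      (∀ y, HasDerivAt φ (ψ y) y) ∧
      (∀ y, HasDerivAt ψ ((α : ℂ) ^ 2 * φ y - p y * ψ y) y) := by
  have hαc : (α : ℂ) ≠ 0 := by exact_mod_cast hα.ne'
  have hE : ∀ y : ℝ, ((Real.exp (α * y) : ℝ) : ℂ) * ((Real.exp (-α * y) : ℝ) : ℂ) = 1 := by
    intro y
    rw [← Complex.ofReal_mul, ← Real.exp_add]; simp
  refine ⟨_, fun y => rfl, fun y => ?_, fun y => ?_⟩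
  · have h := ((((hasDerivAt_cexp α y).mul (ha y)).sub ((hasDerivAt_cexp (-α) y).mul (hb y))).div_const
      (2 * (α : ℂ)))
    refine HasDerivAt.congr_deriv h ?_
    rw [div_eq_iff (by simpa using hαc)]
    have := hψ y
    have e := hE y
    push_cast at *
    generalize Complex.exp (α * y) = E at *
    generalize Complex.exp (-α * y) = F at *
    generalize a y = A at *
    generalize b y = B at *
    linear_combination (-2 * (α : ℂ)) * this
  · have h := ((((hasDerivAt_cexp α y).mul (ha y)).add ((hasDerivAt_cexp (-α) y).mul (hb y))).div_const
      (2 : ℂ))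
    have h' := h.congr_of_eventuallyEq (Eventually.of_forall hψ)
    refine h'.congr_deriv ?_
    have e := hE y
    push_cast at *
    generalize Complex.exp (α * y) = E at *
    generalize Complex.exp (-α * y) = F at *
    generalize a y = A at *
    generalize b y = B at *
    generalize p y * ψ y = Q at *
    field_simp
    linear_combination -2 * Q * e

theorem hasDerivAt_N (D η : ℝ) (hη : 0 < η) (y : ℝ) :
    HasDerivAt (fun s => D / η * Real.exp (-η * s)) (-(D * Real.exp (-η * y))) y := by
  have h : HasDerivAt (fun y : ℝ => Real.exp (-η * y)) (Real.exp (-η * y) * (-η * 1)) y :=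
    ((hasDerivAt_id y).const_mul (-η)).exp
  refine (h.const_mul (D / η)).congr_deriv ?_
  field_simp

theorem tendsto_N (D η : ℝ) (hη : 0 < η) :
    Tendsto (fun s => D / η * Real.exp (-η * s)) atTop (nhds 0) := by
  have h : Tendsto (fun s : ℝ => Real.exp (-η * s)) atTop (nhds 0) := by
    refine Real.tendsto_exp_atBot.comp ?_
    exact tendsto_id.const_mul_atTop_of_neg (by linarith)
  simpa using h.const_mul (D / η)

theorem tail_facts (D η : ℝ) (hD : 0 ≤ D) (hη : 0 < η) (y : ℝ) :
    IntegrableOn (fun s => D * Real.exp (-η * s) * Real.exp (2 * (D / η * Real.exp (-η * s))))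
      (Ioi y) ∧
    ∫ s in Ioi y, D * Real.exp (-η * s) * Real.exp (2 * (D / η * Real.exp (-η * s))) =
      (Real.exp (2 * (D / η * Real.exp (-η * y))) - 1) / 2 := by
  have hd : ∀ x ∈ Ici y, HasDerivAt (fun s => -(Real.exp (2 * (D / η * Real.exp (-η * s))) / 2))
      (D * Real.exp (-η * x) * Real.exp (2 * (D / η * Real.exp (-η * x)))) x := by
    intro x _
    have := ((((hasDerivAt_N D η hη x).const_mul 2).exp).div_const 2).neg
    refine this.congr_deriv ?_
    ring
  have hl : Tendsto (fun s => -(Real.exp (2 * (D / η * Real.exp (-η * s))) / 2)) atTop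
      (nhds (-(Real.exp (2 * 0) / 2))) :=
    (((Real.continuous_exp.tendsto _).comp ((tendsto_N D η hη).const_mul 2)).div_const 2).neg
  have hi := integrableOn_Ioi_deriv_of_nonneg' hd (fun x _ => by positivity) hl
  refine ⟨hi, ?_⟩
  rw [integral_Ioi_of_hasDerivAt_of_tendsto' hd hi hl]
  simp; ring

theorem dec_bound (α D η : ℝ) (hα : 0 < α) (hD : 0 ≤ D) (hη : 0 < η) (p : ℝ → ℂ)
    (hpc : Continuous p) (hp : ∀ y, ‖p y‖ ≤ D * Real.exp (-η * y)) (σ : ℝ) (hσ : 0 ≤ σ + α)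
    (ψ : ℝ → ℂ) (C : ℝ) (hψ : Continuous ψ)
    (hC : ∀ y, ‖ψ y‖ ≤ C * (Real.exp (-α * y) * Real.exp (2 * (D / η * Real.exp (-η * y)))))
    (y : ℝ) :
    IntegrableOn (fun s => ((Real.exp (-σ * s) : ℝ) : ℂ) * (p s * ψ s)) (Ioi y) ∧
    ‖∫ s in Ioi y, ((Real.exp (-σ * s) : ℝ) : ℂ) * (p s * ψ s)‖ ≤
      Real.exp (-(σ + α) * y) * (C * ((Real.exp (2 * (D / η * Real.exp (-η * y))) - 1) / 2)) := by
  have hC0 : 0 ≤ C := by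
    have h := (norm_nonneg _).trans (hC 0)
    exact nonneg_of_mul_nonneg_left h (by positivity)
  obtain ⟨t1, t2⟩ := tail_facts D η hD hη y
  have hb : ∀ s ∈ Ioi y, ‖((Real.exp (-σ * s) : ℝ) : ℂ) * (p s * ψ s)‖ ≤
      Real.exp (-(σ + α) * y) * (C * (D * Real.exp (-η * s) *
        Real.exp (2 * (D / η * Real.exp (-η * s))))) := by
    intro s hs
    have hs : y < s := hs
    rw [norm_mul, norm_mul, Complex.norm_real, Real.norm_eq_abs, Real.abs_exp]
    have h1 : Real.exp (-σ * s) * Real.exp (-α * s) ≤ Real.exp (-(σ + α) * y) := by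
      rw [← Real.exp_add]
      apply Real.exp_le_exp.2
      nlinarith
    calc Real.exp (-σ * s) * (‖p s‖ * ‖ψ s‖)
        ≤ Real.exp (-σ * s) * ((D * Real.exp (-η * s)) *
          (C * (Real.exp (-α * s) * Real.exp (2 * (D / η * Real.exp (-η * s)))))) := by
          gcongr
          · exact hp s
          · exact hC s
      _ = (Real.exp (-σ * s) * Real.exp (-α * s)) * (C * (D * Real.exp (-η * s) *
        Real.exp (2 * (D / η * Real.exp (-η * s))))) := by ring
      _ ≤ _ := by gcongr
  have hi : IntegrableOn (fun s => Real.exp (-(σ + α) * y) * (C * (D * Real.exp (-η * s) *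
        Real.exp (2 * (D / η * Real.exp (-η * s)))))) (Ioi y) := (t1.const_mul C).const_mul _
  have hae := (ae_restrict_mem (μ := volume) (measurableSet_Ioi (a := y))).mono hb
  constructor
  · refine Integrable.mono' hi ?_ hae
    exact (by fun_prop : Continuous _).aestronglyMeasurable
  · refine (norm_integral_le_of_norm_le hi hae).trans (le_of_eq ?_)
    rw [integral_const_mul, integral_const_mul, t2]

theorem hasDerivAt_tail (f : ℝ → ℂ) (hf : Continuous f) (hi : ∀ y, IntegrableOn f (Ioi y)) (y : ℝ) :
    HasDerivAt (fun y => ∫ s in Ioi y, f s) (-(f y)) y := by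
  have e : (fun y => ∫ s in Ioi y, f s) = fun y => (∫ s in Ioi 0, f s) - ∫ s in (0:ℝ)..y, f s := by
    funext y
    rw [← intervalIntegral.integral_interval_add_Ioi (hi 0) (hi y)]
    ring
  rw [e]
  exact (intervalIntegral.integral_hasDerivAt_right (hf.intervalIntegrable _ _)
    (hf.stronglyMeasurableAtFilter _ _) hf.continuousAt).const_sub _

theorem dec_core (α D η : ℝ) (hα : 0 < α) (hD : 0 ≤ D) (hη : 0 < η) (p : ℝ → ℂ)
    (hpc : Continuous p) (hp : ∀ y, ‖p y‖ ≤ D * Real.exp (-η * y)) :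
    ∃ φ ψ : ℝ → ℂ, (∀ y, HasDerivAt φ (ψ y) y) ∧
      (∀ y, HasDerivAt ψ ((α : ℂ) ^ 2 * φ y - p y * ψ y) y) ∧ ∃ C : ℂ, C ≠ 0 ∧
      Tendsto (fun y : ℝ => ((Real.exp (-((-α) * y)) : ℝ) : ℂ) * φ y) atTop (nhds C) ∧
      Tendsto (fun y : ℝ => ((Real.exp (-((-α) * y)) : ℝ) : ℂ) * ψ y) atTop
        (nhds (((-α : ℝ) : ℂ) * C)) := by
  have hαc : (α : ℂ) ≠ 0 := by exact_mod_cast hα.ne'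
  set ω : ℝ → ℝ := fun y => Real.exp (-α * y) * Real.exp (2 * (D / η * Real.exp (-η * y))) with hω
  have cont_tail : ∀ (σ : ℝ), 0 ≤ σ + α → ∀ (ψ : ℝ → ℂ) (C : ℝ), Continuous ψ →
      (∀ y, ‖ψ y‖ ≤ C * ω y) → ∀ y, HasDerivAt
        (fun y => ∫ s in Ioi y, ((Real.exp (-σ * s) : ℝ) : ℂ) * (p s * ψ s))
        (-(((Real.exp (-σ * y) : ℝ) : ℂ) * (p y * ψ y))) y := by
    intro σ hσ ψ C hψ hC y
    exact hasDerivAt_tail _ (by fun_prop)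
      (fun y => (dec_bound α D η hα hD hη p hpc hp σ hσ ψ C hψ hC y).1) y
  obtain ⟨ψ, hψc, hψb, hψe⟩ := fix_lemma ω (by fun_prop) (fun y => by positivity)
    (fun y => ((Real.exp (-α * y) : ℝ) : ℂ)) (by fun_prop) 1
    (by
      intro y
      rw [Complex.norm_real, Real.norm_eq_abs, Real.abs_exp, one_mul]
      refine le_mul_of_one_le_right (Real.exp_pos _).le (Real.one_le_exp (by positivity)))
    (fun ψ y => (((Real.exp (α * y) : ℝ) : ℂ) *
        (∫ s in Ioi y, ((Real.exp (-α * s) : ℝ) : ℂ) * (p s * ψ s)) +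
      ((Real.exp (-α * y) : ℝ) : ℂ) *
        (∫ s in Ioi y, ((Real.exp (-(-α) * s) : ℝ) : ℂ) * (p s * ψ s))) / 2)
    (by
      intro ψ C hψ hC
      have c1 : Continuous fun y => ∫ s in Ioi y, ((Real.exp (-α * s) : ℝ) : ℂ) * (p s * ψ s) :=
        continuous_iff_continuousAt.2 fun y =>
          (cont_tail α (by linarith) ψ C hψ hC y).continuousAt
      have c2 : Continuous fun y => ∫ s in Ioi y, ((Real.exp (-(-α) * s) : ℝ) : ℂ) * (p s * ψ s) :=
        continuous_iff_continuousAt.2 fun y =>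
          (cont_tail (-α) (by linarith) ψ C hψ hC y).continuousAt
      fun_prop)
    (by
      intro ψ C hψ hC y
      have hC0 : 0 ≤ C := by
        have h := (norm_nonneg _).trans (hC 0)
        exact nonneg_of_mul_nonneg_left h (by positivity)
      have b1 := (dec_bound α D η hα hD hη p hpc hp α (by linarith) ψ C hψ hC y).2
      have b2 := (dec_bound α D η hα hD hη p hpc hp (-α) (by linarith) ψ C hψ hC y).2
      rw [norm_div, RCLike.norm_ofNat, div_le_iff₀ (by norm_num)]
      refine (norm_add_le _ _).trans ?_
      rw [norm_mul, norm_mul, Complex.norm_real, Real.norm_eq_abs, Real.abs_exp,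
        Complex.norm_real, Real.norm_eq_abs, Real.abs_exp]
      have e1 : Real.exp (α * y) * Real.exp (-(α + α) * y) = Real.exp (-α * y) := by
        rw [← Real.exp_add]; congr 1; ring
      have e2 : Real.exp (-(-α + α) * y) = 1 := by simp
      have f1 := mul_le_mul_of_nonneg_left b1 (Real.exp_pos (α * y)).le
      have f2 := mul_le_mul_of_nonneg_left b2 (Real.exp_pos (-α * y)).le
      rw [← mul_assoc, e1] at f1
      rw [e2, one_mul] at f2
      refine (add_le_add f1 f2).trans ?_
      simp only [hω]
      have : 0 ≤ C * Real.exp (-α * y) := by positivity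
      nlinarith)
    (by
      intro ψ₁ ψ₂ C₁ C₂ h1 b1 h2 b2 y
      have i1 := fun σ hσ => (dec_bound α D η hα hD hη p hpc hp σ hσ ψ₁ C₁ h1 b1 y).1
      have i2 := fun σ hσ => (dec_bound α D η hα hD hη p hpc hp σ hσ ψ₂ C₂ h2 b2 y).1
      have hs : ∀ σ : ℝ, 0 ≤ σ + α →
          ∫ s in Ioi y, ((Real.exp (-σ * s) : ℝ) : ℂ) * (p s * (ψ₁ s - ψ₂ s)) =
          (∫ s in Ioi y, ((Real.exp (-σ * s) : ℝ) : ℂ) * (p s * ψ₁ s)) -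
          ∫ s in Ioi y, ((Real.exp (-σ * s) : ℝ) : ℂ) * (p s * ψ₂ s) := by
        intro σ hσ
        rw [← integral_sub (i1 σ hσ) (i2 σ hσ)]
        congr 1; funext s; ring
      simp only []
      rw [hs α (by linarith), hs (-α) (by linarith)]
      ring)
  set a : ℝ → ℂ := fun y => ∫ s in Ioi y, ((Real.exp (-α * s) : ℝ) : ℂ) * (p s * ψ s) with ha
  set b : ℝ → ℂ := fun y => 2 + ∫ s in Ioi y, ((Real.exp (-(-α) * s) : ℝ) : ℂ) * (p s * ψ s) with hb
  have da := cont_tail α (by linarith) ψ _ hψc hψb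
  have db := cont_tail (-α) (by linarith) ψ _ hψc hψb
  have hψ' : ∀ y, ψ y = (((Real.exp (α * y) : ℝ) : ℂ) * a y +
      ((Real.exp (-α * y) : ℝ) : ℂ) * b y) / 2 := by
    intro y
    rw [hψe y]; simp only [ha, hb]; ring
  obtain ⟨φ, hφ, s1, s2⟩ := system_of_ab α hα p ψ a b da
    (fun y => by simpa [hb] using (db y).const_add 2) hψ'
  have hG : Tendsto (fun y : ℝ => 2 * 1 *
      ((Real.exp (2 * (D / η * Real.exp (-η * y))) - 1) / 2)) atTop (nhds 0) := by
    have := ((((Real.continuous_exp.tendsto _).comp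
      ((tendsto_N D η hη).const_mul 2)).sub_const 1).div_const 2).const_mul (2 * 1)
    simpa using this
  have la : Tendsto (fun y : ℝ => ((Real.exp (2 * α * y) : ℝ) : ℂ) * a y) atTop (nhds 0) := by
    refine squeeze_zero_norm (fun y => ?_) hG
    have b1 := (dec_bound α D η hα hD hη p hpc hp α (by linarith) ψ _ hψc hψb y).2
    have f1 := mul_le_mul_of_nonneg_left b1 (Real.exp_pos (2 * α * y)).le
    rw [← mul_assoc, ← Real.exp_add, show 2 * α * y + -(α + α) * y = 0 by ring, Real.exp_zero,
      one_mul] at f1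
    rw [norm_mul, Complex.norm_real, Real.norm_eq_abs, Real.abs_exp]
    exact f1
  have lb : Tendsto b atTop (nhds 2) := by
    have : Tendsto (fun y => ∫ s in Ioi y, ((Real.exp (-(-α) * s) : ℝ) : ℂ) * (p s * ψ s)) atTop
        (nhds 0) := by
      refine squeeze_zero_norm (fun y => ?_) hG
      have b1 := (dec_bound α D η hα hD hη p hpc hp (-α) (by linarith) ψ _ hψc hψb y).2
      simpa using b1
    have h2 := this.const_add 2
    rw [add_zero] at h2
    exact h2
  have hE : ∀ y : ℝ, ((Real.exp (-(-α * y)) : ℝ) : ℂ) * ((Real.exp (α * y) : ℝ) : ℂ) =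
      ((Real.exp (2 * α * y) : ℝ) : ℂ) := by
    intro y
    rw [← Complex.ofReal_mul, ← Real.exp_add]; congr 2; ring
  have hE2 : ∀ y : ℝ, ((Real.exp (-(-α * y)) : ℝ) : ℂ) * ((Real.exp (-α * y) : ℝ) : ℂ) = 1 := by
    intro y
    rw [← Complex.ofReal_mul, ← Real.exp_add]; simp
  refine ⟨φ, ψ, s1, s2, -(1 / α), by simpa using hαc, ?_, ?_⟩
  · have := (la.sub lb).div_const (2 * (α : ℂ))
    convert this using 2
    · rw [hφ, ← hE]
      linear_combination (- b _ / (2 * α)) * hE2 _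
    · field_simp; ring
  · have := (la.add lb).div_const (2 : ℂ)
    convert this using 2
    · rw [hψ', ← hE]
      linear_combination (b _ / 2) * hE2 _
    · push_cast; field_simp; ring

theorem grow_int (D η Y y : ℝ) (hη : 0 < η) :
    |∫ s in Y..y, D * Real.exp (-η * s) *
      Real.exp (2 * |D / η * Real.exp (-η * Y) - D / η * Real.exp (-η * s)|)| =
    |(Real.exp (2 * |D / η * Real.exp (-η * Y) - D / η * Real.exp (-η * y)|) - 1) / 2| ∨ D < 0 := by
  rcases lt_or_ge D 0 with hD | hD
  · exact Or.inr hD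
  left
  have hmono : ∀ s t : ℝ, s ≤ t → D / η * Real.exp (-η * t) ≤ D / η * Real.exp (-η * s) := by
    intro s t hst
    have : Real.exp (-η * t) ≤ Real.exp (-η * s) := Real.exp_le_exp.2 (by nlinarith)
    have h0 : 0 ≤ D / η := by positivity
    exact mul_le_mul_of_nonneg_left this h0
  rcases le_total Y y with h | h
  · have e : ∫ s in Y..y, D * Real.exp (-η * s) *
      Real.exp (2 * |D / η * Real.exp (-η * Y) - D / η * Real.exp (-η * s)|) =
      ∫ s in Y..y, D * Real.exp (-η * s) *
      Real.exp (2 * (D / η * Real.exp (-η * Y) - D / η * Real.exp (-η * s))) := by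
      refine intervalIntegral.integral_congr fun s hs => ?_
      rw [uIcc_of_le h] at hs
      beta_reduce
      rw [abs_of_nonneg (sub_nonneg.2 (hmono _ _ hs.1))]
    rw [e, abs_of_nonneg (sub_nonneg.2 (hmono _ _ h))]
    rw [intervalIntegral.integral_eq_sub_of_hasDerivAt
      (f := fun s => Real.exp (2 * (D / η * Real.exp (-η * Y) - D / η * Real.exp (-η * s))) / 2)]
    · congr 1; simp; ring
    · intro x _
      have := ((((hasDerivAt_N D η hη x).const_sub (D / η * Real.exp (-η * Y))).const_mul
        2).exp).div_const 2
      refine this.congr_deriv ?_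
      ring
    · exact (by fun_prop : Continuous _).intervalIntegrable _ _
  · have e : ∫ s in Y..y, D * Real.exp (-η * s) *
      Real.exp (2 * |D / η * Real.exp (-η * Y) - D / η * Real.exp (-η * s)|) =
      ∫ s in Y..y, D * Real.exp (-η * s) *
      Real.exp (2 * (D / η * Real.exp (-η * s) - D / η * Real.exp (-η * Y))) := by
      refine intervalIntegral.integral_congr fun s hs => ?_
      rw [uIcc_of_ge h] at hs
      beta_reduce
      rw [abs_of_nonpos (sub_nonpos.2 (hmono _ _ hs.2)), neg_sub]
    rw [e, abs_of_nonpos (sub_nonpos.2 (hmono _ _ h)), neg_sub]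
    rw [intervalIntegral.integral_eq_sub_of_hasDerivAt
      (f := fun s => -(Real.exp (2 * (D / η * Real.exp (-η * s) - D / η * Real.exp (-η * Y))) / 2))]
    · rw [← abs_neg]; congr 1; simp; ring
    · intro x _
      have := (((((hasDerivAt_N D η hη x).sub_const (D / η * Real.exp (-η * Y))).const_mul
        2).exp).div_const 2).neg
      refine this.congr_deriv ?_
      ring
    · exact (by fun_prop : Continuous _).intervalIntegrable _ _

theorem grow_bound (α D η Y : ℝ) (hα : 0 < α) (hD : 0 ≤ D) (hη : 0 < η) (p : ℝ → ℂ)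
    (hp : ∀ y, ‖p y‖ ≤ D * Real.exp (-η * y)) (σ : ℝ) (hσ : |σ| = α)
    (ψ : ℝ → ℂ) (C : ℝ)
    (hC : ∀ y, ‖ψ y‖ ≤ C * (Real.exp (α * |y - Y|) *
      Real.exp (2 * |D / η * Real.exp (-η * Y) - D / η * Real.exp (-η * y)|)))
    (y : ℝ) :
    Real.exp (σ * y) * ‖∫ s in Y..y, ((Real.exp (-σ * s) : ℝ) : ℂ) * (p s * ψ s)‖ ≤
      C / 2 * (Real.exp (α * |y - Y|) *
      (Real.exp (2 * |D / η * Real.exp (-η * Y) - D / η * Real.exp (-η * y)|) - 1)) := by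
  have hC0 : 0 ≤ C := by
    have h := (norm_nonneg _).trans (hC 0)
    exact nonneg_of_mul_nonneg_left h (by positivity)
  have hb : ∀ s ∈ Set.uIoc Y y, ‖((Real.exp (-σ * s) : ℝ) : ℂ) * (p s * ψ s)‖ ≤
      (Real.exp (-σ * y) * Real.exp (α * |y - Y|) * C) * (D * Real.exp (-η * s) *
        Real.exp (2 * |D / η * Real.exp (-η * Y) - D / η * Real.exp (-η * s)|)) := by
    intro s hs
    rw [norm_mul, norm_mul, Complex.norm_real, Real.norm_eq_abs, Real.abs_exp]
    have h1 : Real.exp (-σ * s) * Real.exp (α * |s - Y|) ≤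
        Real.exp (-σ * y) * Real.exp (α * |y - Y|) := by
      rw [← Real.exp_add, ← Real.exp_add]
      apply Real.exp_le_exp.2
      have k1 : σ * (y - s) ≤ α * |y - s| := by
        rw [← hσ, ← abs_mul]; exact le_abs_self _
      have k2 : |y - s| + |s - Y| = |y - Y| := by
        rcases le_total Y y with h | h
        · rw [uIoc_of_le h] at hs
          rw [abs_of_nonneg (by linarith [hs.2]), abs_of_nonneg (by linarith [hs.1]),
            abs_of_nonneg (by linarith)]; ring
        · rw [uIoc_of_ge h] at hs
          rw [abs_of_nonpos (by linarith [hs.1]), abs_of_nonpos (by linarith [hs.2]),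
            abs_of_nonpos (by linarith)]; ring
      rw [← k2]
      linarith
    calc Real.exp (-σ * s) * (‖p s‖ * ‖ψ s‖)
        ≤ Real.exp (-σ * s) * ((D * Real.exp (-η * s)) *
          (C * (Real.exp (α * |s - Y|) *
      Real.exp (2 * |D / η * Real.exp (-η * Y) - D / η * Real.exp (-η * s)|)))) := by
          gcongr
          · exact hp s
          · exact hC s
      _ = (Real.exp (-σ * s) * Real.exp (α * |s - Y|)) * (C * (D * Real.exp (-η * s) *
        Real.exp (2 * |D / η * Real.exp (-η * Y) - D / η * Real.exp (-η * s)|))) := by ring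
      _ ≤ (Real.exp (-σ * y) * Real.exp (α * |y - Y|)) * (C * (D * Real.exp (-η * s) *
        Real.exp (2 * |D / η * Real.exp (-η * Y) - D / η * Real.exp (-η * s)|))) := by gcongr
      _ = _ := by ring
  have hae := (ae_restrict_mem (μ := volume) (measurableSet_uIoc (a := Y) (b := y))).mono hb
  have h := intervalIntegral.norm_integral_le_abs_of_norm_le hae
    ((by fun_prop : Continuous _).intervalIntegrable _ _)
  have hg := (grow_int D η Y y hη).resolve_right (not_lt.2 hD)
  have hpos : 0 ≤ (Real.exp (2 * |D / η * Real.exp (-η * Y) - D / η * Real.exp (-η * y)|) - 1) / 2 := by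
    have : 1 ≤ Real.exp (2 * |D / η * Real.exp (-η * Y) - D / η * Real.exp (-η * y)|) :=
      Real.one_le_exp (by positivity)
    linarith
  rw [intervalIntegral.integral_const_mul, abs_mul, hg, abs_of_nonneg hpos,
    abs_of_nonneg (by positivity)] at h
  have h3 := mul_le_mul_of_nonneg_left h (Real.exp_pos (σ * y)).le
  refine h3.trans (le_of_eq ?_)
  have : Real.exp (σ * y) * Real.exp (-σ * y) = 1 := by
    rw [← Real.exp_add]; simp
  linear_combination (Real.exp (α * |y - Y|) * C *
    ((Real.exp (2 * |D / η * Real.exp (-η * Y) - D / η * Real.exp (-η * y)|) - 1) / 2)) * this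

theorem grow_core (α D η : ℝ) (hα : 0 < α) (hD : 0 ≤ D) (hη : 0 < η) (hηα : η ≤ α) (p : ℝ → ℂ)
    (hpc : Continuous p) (hp : ∀ y, ‖p y‖ ≤ D * Real.exp (-η * y)) :
    ∃ φ ψ : ℝ → ℂ, (∀ y, HasDerivAt φ (ψ y) y) ∧
      (∀ y, HasDerivAt ψ ((α : ℂ) ^ 2 * φ y - p y * ψ y) y) ∧ ∃ C : ℂ, C ≠ 0 ∧
      Tendsto (fun y : ℝ => ((Real.exp (-(α * y)) : ℝ) : ℂ) * φ y) atTop (nhds C) ∧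
      Tendsto (fun y : ℝ => ((Real.exp (-(α * y)) : ℝ) : ℂ) * ψ y) atTop
        (nhds ((α : ℂ) * C)) := by
  have hαc : (α : ℂ) ≠ 0 := by exact_mod_cast hα.ne'
  have habs : |α| = α := abs_of_pos hα
  have habs' : |-α| = α := by rw [abs_neg, habs]
  -- choose the base point
  obtain ⟨Y, hY⟩ : ∃ Y : ℝ, Real.exp (2 * (D / η * Real.exp (-η * Y))) < 3 / 2 := by
    have := (Real.continuous_exp.tendsto _).comp ((tendsto_N D η hη).const_mul 2)
    simp only [mul_zero, Real.exp_zero] at this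
    exact (this.eventually_lt_const (by norm_num : (1:ℝ) < 3 / 2)).exists
  set ω : ℝ → ℝ := fun y => Real.exp (α * |y - Y|) *
      Real.exp (2 * |D / η * Real.exp (-η * Y) - D / η * Real.exp (-η * y)|) with hω
  have cont_int : ∀ (σ : ℝ) (ψ : ℝ → ℂ), Continuous ψ → ∀ y, HasDerivAt
        (fun y => ∫ s in Y..y, ((Real.exp (-σ * s) : ℝ) : ℂ) * (p s * ψ s))
        (((Real.exp (-σ * y) : ℝ) : ℂ) * (p y * ψ y)) y := by
    intro σ ψ hψ y
    have hf : Continuous fun s => ((Real.exp (-σ * s) : ℝ) : ℂ) * (p s * ψ s) := by fun_prop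
    exact intervalIntegral.integral_hasDerivAt_right (hf.intervalIntegrable _ _)
      (hf.stronglyMeasurableAtFilter _ _) hf.continuousAt
  obtain ⟨ψ, hψc, hψb, hψe⟩ := fix_lemma ω (by fun_prop) (fun y => by positivity)
    (fun y => ((Real.exp (α * (y - Y)) : ℝ) : ℂ)) (by fun_prop) 1
    (by
      intro y
      rw [Complex.norm_real, Real.norm_eq_abs, Real.abs_exp, one_mul]
      have h1 : Real.exp (α * (y - Y)) ≤ Real.exp (α * |y - Y|) :=
        Real.exp_le_exp.2 (mul_le_mul_of_nonneg_left (le_abs_self _) hα.le)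
      exact h1.trans (le_mul_of_one_le_right (Real.exp_pos _).le (Real.one_le_exp (by positivity))))
    (fun ψ y => -(((Real.exp (α * y) : ℝ) : ℂ) *
        (∫ s in Y..y, ((Real.exp (-α * s) : ℝ) : ℂ) * (p s * ψ s)) +
      ((Real.exp (-α * y) : ℝ) : ℂ) *
        (∫ s in Y..y, ((Real.exp (-(-α) * s) : ℝ) : ℂ) * (p s * ψ s))) / 2)
    (by
      intro ψ C hψ hC
      have c1 : Continuous fun y => ∫ s in Y..y, ((Real.exp (-α * s) : ℝ) : ℂ) * (p s * ψ s) :=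
        continuous_iff_continuousAt.2 fun y => (cont_int α ψ hψ y).continuousAt
      have c2 : Continuous fun y => ∫ s in Y..y, ((Real.exp (-(-α) * s) : ℝ) : ℂ) * (p s * ψ s) :=
        continuous_iff_continuousAt.2 fun y => (cont_int (-α) ψ hψ y).continuousAt
      fun_prop)
    (by
      intro ψ C hψ hC y
      have hC0 : 0 ≤ C := by
        have h := (norm_nonneg _).trans (hC 0)
        exact nonneg_of_mul_nonneg_left h (by positivity)
      have b1 := grow_bound α D η Y hα hD hη p hp α habs ψ C hC y
      have b2 := grow_bound α D η Y hα hD hη p hp (-α) habs' ψ C hC y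
      rw [norm_div, RCLike.norm_ofNat, div_le_iff₀ (by norm_num), norm_neg]
      refine (norm_add_le _ _).trans ?_
      rw [norm_mul, norm_mul, Complex.norm_real, Real.norm_eq_abs, Real.abs_exp,
        Complex.norm_real, Real.norm_eq_abs, Real.abs_exp]
      refine (add_le_add b1 b2).trans ?_
      simp only [hω]
      have : 0 ≤ C * Real.exp (α * |y - Y|) := by positivity
      nlinarith)
    (by
      intro ψ₁ ψ₂ C₁ C₂ h1 b1 h2 b2 y
      have hs : ∀ σ : ℝ,
          ∫ s in Y..y, ((Real.exp (-σ * s) : ℝ) : ℂ) * (p s * (ψ₁ s - ψ₂ s)) =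
          (∫ s in Y..y, ((Real.exp (-σ * s) : ℝ) : ℂ) * (p s * ψ₁ s)) -
          ∫ s in Y..y, ((Real.exp (-σ * s) : ℝ) : ℂ) * (p s * ψ₂ s) := by
        intro σ
        rw [← intervalIntegral.integral_sub
          ((by fun_prop : Continuous _).intervalIntegrable _ _)
          ((by fun_prop : Continuous _).intervalIntegrable _ _)]
        congr 1; funext s; ring
      simp only []
      rw [hs α, hs (-α)]
      ring)
  rw [mul_one] at hψb
  set f : ℝ → ℂ := fun s => ((Real.exp (-α * s) : ℝ) : ℂ) * (p s * ψ s) with hf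
  set a : ℝ → ℂ := fun y => 2 * ((Real.exp (-α * Y) : ℝ) : ℂ) - ∫ s in Y..y, f s with ha
  set b : ℝ → ℂ := fun y => -∫ s in Y..y, ((Real.exp (-(-α) * s) : ℝ) : ℂ) * (p s * ψ s) with hb
  have da : ∀ y, HasDerivAt a (-(((Real.exp (-α * y) : ℝ) : ℂ) * (p y * ψ y))) y :=
    fun y => (cont_int α ψ hψc y).const_sub _
  have db : ∀ y, HasDerivAt b (-(((Real.exp (α * y) : ℝ) : ℂ) * (p y * ψ y))) y := fun y => by
    have := (cont_int (-α) ψ hψc y).neg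
    exact this.congr_deriv (by rw [neg_neg])
  have hψ' : ∀ y, ψ y = (((Real.exp (α * y) : ℝ) : ℂ) * a y +
      ((Real.exp (-α * y) : ℝ) : ℂ) * b y) / 2 := by
    intro y
    have : ((Real.exp (α * (y - Y)) : ℝ) : ℂ) =
        ((Real.exp (α * y) : ℝ) : ℂ) * ((Real.exp (-α * Y) : ℝ) : ℂ) := by
      rw [← Complex.ofReal_mul, ← Real.exp_add]; congr 2; ring
    rw [hψe y, this]; simp only [ha, hb, hf]; ring
  obtain ⟨φ, hφ, s1, s2⟩ := system_of_ab α hα p ψ a b da db hψ'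
  -- pointwise bounds to the right of the base point
  have hNY : ∀ s, Y ≤ s → |D / η * Real.exp (-η * Y) - D / η * Real.exp (-η * s)| ≤
      D / η * Real.exp (-η * Y) := by
    intro s hs
    have h1 : Real.exp (-η * s) ≤ Real.exp (-η * Y) := Real.exp_le_exp.2 (by nlinarith)
    have h0 : 0 ≤ D / η := by positivity
    have h2 := mul_le_mul_of_nonneg_left h1 h0
    have h3 : 0 ≤ D / η * Real.exp (-η * s) := by positivity
    rw [abs_of_nonneg (by linarith)]
    linarith
  have hωY : ∀ s, Y ≤ s → ω s ≤ Real.exp (-α * Y) * Real.exp (α * s) * (3 / 2) := by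
    intro s hs
    have h1 : Real.exp (2 * |D / η * Real.exp (-η * Y) - D / η * Real.exp (-η * s)|) ≤ 3 / 2 :=
      (Real.exp_le_exp.2 (by linarith [hNY s hs])).trans hY.le
    simp only [hω]
    have e : Real.exp (-α * Y) * Real.exp (α * s) = Real.exp (α * (s - Y)) := by
      rw [← Real.exp_add]; congr 1; ring
    rw [abs_of_nonneg (by linarith : 0 ≤ s - Y), e]
    gcongr
  set K := Real.exp (-α * Y) * 3 * D with hK
  have hK0 : 0 ≤ K := by positivity
  have hpt : ∀ s, Y ≤ s → ‖p s * ψ s‖ ≤ K * (Real.exp (α * s) * Real.exp (-η * s)) := by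
    intro s hs
    rw [norm_mul]
    calc ‖p s‖ * ‖ψ s‖ ≤ (D * Real.exp (-η * s)) *
          (2 * (Real.exp (-α * Y) * Real.exp (α * s) * (3 / 2))) := by
          gcongr
          · exact hp s
          · exact (hψb s).trans (by linarith [hωY s hs])
      _ = _ := by rw [hK]; ring
  have hfi : IntegrableOn f (Ioi Y) := by
    have hi : IntegrableOn (fun s => K * Real.exp (-η * s)) (Ioi Y) :=
      (integrableOn_exp_mul_Ioi (by linarith) Y).const_mul K
    refine Integrable.mono' hi (by
      exact (by fun_prop : Continuous f).aestronglyMeasurable) ?_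
    refine (ae_restrict_mem (μ := volume) (measurableSet_Ioi (a := Y))).mono fun s hs => ?_
    have hs : Y < s := hs
    have h := hpt s hs.le
    simp only [hf]
    rw [norm_mul, Complex.norm_real, Real.norm_eq_abs, Real.abs_exp]
    have e : Real.exp (-α * s) * Real.exp (α * s) = 1 := by rw [← Real.exp_add]; simp
    calc Real.exp (-α * s) * ‖p s * ψ s‖ ≤
        Real.exp (-α * s) * (K * (Real.exp (α * s) * Real.exp (-η * s))) := by gcongr
      _ = _ := by linear_combination (K * Real.exp (-η * s)) * e
  have lI := intervalIntegral_tendsto_integral_Ioi Y hfi tendsto_id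
  set I := ∫ s in Ioi Y, f s with hI
  have hIb : ‖I‖ ≤ Real.exp (-α * Y) / 2 := by
    refine le_of_tendsto lI.norm ?_
    filter_upwards [eventually_ge_atTop Y] with y hy
    have b1 := grow_bound α D η Y hα hD hη p hp α habs ψ 2 hψb y
    have h1 : Real.exp (2 * |D / η * Real.exp (-η * Y) - D / η * Real.exp (-η * y)|) ≤ 3 / 2 :=
      (Real.exp_le_exp.2 (by linarith [hNY y hy])).trans hY.le
    rw [abs_of_nonneg (by linarith : 0 ≤ y - Y)] at b1
    have e : Real.exp (α * (y - Y)) = Real.exp (α * y) * Real.exp (-α * Y) := by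
      rw [← Real.exp_add]; congr 1; ring
    rw [e] at b1
    have h2 : Real.exp (α * y) * ‖∫ s in Y..y, f s‖ ≤
        Real.exp (α * y) * (Real.exp (-α * Y) / 2) := by
      refine b1.trans ?_
      have : 0 ≤ Real.exp (α * y) * Real.exp (-α * Y) := by positivity
      nlinarith
    exact le_of_mul_le_mul_left h2 (Real.exp_pos _)
  have la : Tendsto a atTop (nhds (2 * ((Real.exp (-α * Y) : ℝ) : ℂ) - I)) := lI.const_sub _
  have hane : 2 * ((Real.exp (-α * Y) : ℝ) : ℂ) - I ≠ 0 := by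
    intro h0
    have : ‖I‖ = 2 * Real.exp (-α * Y) := by
      rw [← sub_eq_zero.1 h0, norm_mul, Complex.norm_real, Real.norm_eq_abs, Real.abs_exp]
      simp
    have := Real.exp_pos (-α * Y)
    linarith
  have lb : Tendsto (fun y : ℝ => ((Real.exp (-(2 * α) * y) : ℝ) : ℂ) * b y) atTop (nhds 0) := by
    have l0 := tendsto_N (K * η / (2 * α - η)) η hη
    refine squeeze_zero_norm' ?_ l0
    filter_upwards [eventually_ge_atTop Y] with y hy
    have hpos : 0 < 2 * α - η := by linarith
    have hd : ∀ x ∈ uIcc Y y, HasDerivAt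
        (fun s => K / (2 * α - η) * Real.exp ((2 * α - η) * s)) (K * Real.exp ((2 * α - η) * x)) x := by
      intro x _
      have h : HasDerivAt (fun y : ℝ => Real.exp ((2 * α - η) * y))
        (Real.exp ((2 * α - η) * x) * ((2 * α - η) * 1)) x :=
        ((hasDerivAt_id x).const_mul (2 * α - η)).exp
      refine (h.const_mul (K / (2 * α - η))).congr_deriv ?_
      field_simp
    have hc : IntervalIntegrable (fun x => K * Real.exp ((2 * α - η) * x)) volume Y y :=
      (by fun_prop : Continuous _).intervalIntegrable _ _
    have hn : ‖∫ s in Y..y, ((Real.exp (-(-α) * s) : ℝ) : ℂ) * (p s * ψ s)‖ ≤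
        ∫ s in Y..y, K * Real.exp ((2 * α - η) * s) := by
      refine intervalIntegral.norm_integral_le_of_norm_le hy (Eventually.of_forall ?_) hc
      intro s hs
      rw [norm_mul, Complex.norm_real, Real.norm_eq_abs, Real.abs_exp]
      calc Real.exp (-(-α) * s) * ‖p s * ψ s‖ ≤
          Real.exp (-(-α) * s) * (K * (Real.exp (α * s) * Real.exp (-η * s))) := by
            gcongr; exact hpt s hs.1.le
        _ = K * (Real.exp (-(-α) * s) * Real.exp (α * s) * Real.exp (-η * s)) := by ring
        _ = _ := by
          rw [← Real.exp_add, ← Real.exp_add]; congr 2; ring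
    rw [intervalIntegral.integral_eq_sub_of_hasDerivAt hd hc] at hn
    rw [norm_mul, Complex.norm_real, Real.norm_eq_abs, Real.abs_exp]
    simp only [hb]
    rw [norm_neg]
    have hn2 := hn.trans (sub_le_self _ (by positivity))
    have e : Real.exp (-(2 * α) * y) * Real.exp ((2 * α - η) * y) = Real.exp (-η * y) := by
      rw [← Real.exp_add]; congr 1; ring
    calc _ ≤ Real.exp (-(2 * α) * y) * (K / (2 * α - η) * Real.exp ((2 * α - η) * y)) := by gcongr
      _ = K / (2 * α - η) * Real.exp (-η * y) := by rw [← e]; ring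
      _ = _ := by field_simp
  have hE : ∀ y : ℝ, ((Real.exp (-(α * y)) : ℝ) : ℂ) * ((Real.exp (-α * y) : ℝ) : ℂ) =
      ((Real.exp (-(2 * α) * y) : ℝ) : ℂ) := by
    intro y
    rw [← Complex.ofReal_mul, ← Real.exp_add]; congr 2; ring
  have hE2 : ∀ y : ℝ, ((Real.exp (-(α * y)) : ℝ) : ℂ) * ((Real.exp (α * y) : ℝ) : ℂ) = 1 := by
    intro y
    rw [← Complex.ofReal_mul, ← Real.exp_add]; simp
  refine ⟨φ, ψ, s1, s2, (2 * ((Real.exp (-α * Y) : ℝ) : ℂ) - I) / (2 * α),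
    div_ne_zero hane (by simpa using hαc), ?_, ?_⟩
  · have := (la.sub lb).div_const (2 * (α : ℂ))
    rw [sub_zero] at this
    refine this.congr fun y => ?_
    rw [hφ, ← hE]
    linear_combination (- a y / (2 * α)) * hE2 y
  · have := (la.add lb).div_const (2 : ℂ)
    rw [add_zero] at this
    have e : (α : ℂ) * ((2 * ((Real.exp (-α * Y) : ℝ) : ℂ) - I) / (2 * α)) =
      (2 * ((Real.exp (-α * Y) : ℝ) : ℂ) - I) / 2 := by field_simp
    rw [e]
    refine this.congr fun y => ?_
    rw [hψ', ← hE]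
    linear_combination (-a y / 2) * hE2 y

theorem exists_p (U : ℝ → ℝ) (η₀ : ℝ) (hU : ShearFlow U η₀) (c : ℂ)
    (hc : ∃ δ : ℝ, 0 < δ ∧ ∀ y : ℝ, 0 ≤ y → δ ≤ ‖(U y : ℂ) - c‖) (η : ℝ) (hη : 0 < η)
    (hηη : η ≤ η₀) :
    ∃ p : ℝ → ℂ, ContDiff ℝ (⊤ : ℕ∞) p ∧ (∃ D : ℝ, 0 ≤ D ∧ ∀ y, ‖p y‖ ≤ D * Real.exp (-η * y)) ∧
      (∀ k : ℕ, Tendsto (iteratedDeriv k p) atTop (nhds 0)) ∧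
      ∀ y, 0 ≤ y → ((U y : ℂ) - (starRingEnd ℂ) c) * p y = 2 * ((deriv U y : ℝ) : ℂ) := by
  obtain ⟨hUs, -, -, -, -, -, hη₀, hUd⟩ := hU
  obtain ⟨δ, hδ, hcδ⟩ := hc
  set q : ℝ → ℂ := fun y => (U y : ℂ) - (starRingEnd ℂ) c with hq
  have hqδ : ∀ y, 0 ≤ y → δ ≤ ‖q y‖ := by
    intro y hy
    have : q y = (starRingEnd ℂ) ((U y : ℂ) - c) := by simp [hq]
    rw [this, Complex.norm_conj]
    exact hcδ y hy
  have hUc : ContDiff ℝ (⊤ : ℕ∞) (fun y => (U y : ℂ)) := Complex.ofRealCLM.contDiff.comp hUs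
  have hqs : ContDiff ℝ (⊤ : ℕ∞) q := hUc.sub contDiff_const
  have hU's : ContDiff ℝ (⊤ : ℕ∞) (deriv U) := (contDiff_infty_iff_deriv.1 hUs).2
  have hU'c : ContDiff ℝ (⊤ : ℕ∞) (fun y => ((deriv U y : ℝ) : ℂ)) :=
    Complex.ofRealCLM.contDiff.comp hU's
  -- a neighbourhood of the half line on which q does not vanish
  obtain ⟨ε, hε, hqε⟩ : ∃ ε : ℝ, 0 < ε ∧ ∀ y, -ε < y → q y ≠ 0 := by
    have h0 : q 0 ≠ 0 := by
      intro h; have := hqδ 0 le_rfl; rw [h, norm_zero] at this; linarith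
    have := hqs.continuous.continuousAt.eventually_ne h0
    obtain ⟨ε, hε, h⟩ := Metric.eventually_nhds_iff.1 this
    refine ⟨ε, hε, fun y hy => ?_⟩
    rcases le_or_gt 0 y with h1 | h1
    · intro h2; have := hqδ y h1; rw [h2, norm_zero] at this; linarith
    · apply h; rw [Real.dist_eq, sub_zero, abs_of_neg h1]; linarith
  set χ : ℝ → ℝ := fun y => Real.smoothTransition (1 + 2 / ε * y) with hχ
  have hχs : ContDiff ℝ (⊤ : ℕ∞) χ := by
    have : ContDiff ℝ (⊤ : ℕ∞) (fun y : ℝ => 1 + 2 / ε * y) := by fun_prop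
    exact Real.smoothTransition.contDiff.comp this
  have hχ1 : ∀ y, 0 ≤ y → χ y = 1 := fun y hy =>
    Real.smoothTransition.one_of_one_le (by have : 0 ≤ 2 / ε * y := by positivity
                                            linarith)
  have hχ0 : ∀ y, y ≤ -ε / 2 → χ y = 0 := by
    intro y hy
    refine Real.smoothTransition.zero_of_nonpos ?_
    have : 2 / ε * y ≤ 2 / ε * (-ε / 2) := mul_le_mul_of_nonneg_left hy (by positivity)
    have e : 2 / ε * (-ε / 2) = -1 := by field_simp
    linarith
  set r : ℝ → ℂ := fun y => 2 * (χ y : ℂ) * ((deriv U y : ℝ) : ℂ) with hr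
  have hrs : ContDiff ℝ (⊤ : ℕ∞) r :=
    (contDiff_const.mul (Complex.ofRealCLM.contDiff.comp hχs)).mul hU'c
  set p : ℝ → ℂ := fun y => r y / q y with hp
  have hqp : ∀ y, q y * p y = r y := by
    intro y
    rcases le_or_gt y (-ε / 2) with h | h
    · simp [hp, hr, hχ0 y h]
    · have := hqε y (by linarith)
      simp only [hp]; field_simp
  have hps : ContDiff ℝ (⊤ : ℕ∞) p := by
    rw [contDiff_iff_contDiffAt]
    intro y
    rcases lt_or_ge y (-ε / 2) with h | h
    · have : p =ᶠ[nhds y] fun _ => 0 := by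
        filter_upwards [Iio_mem_nhds h] with z hz
        have hz : z < -ε / 2 := hz
        simp [hp, hr, hχ0 z hz.le]
      exact contDiffAt_const.congr_of_eventuallyEq this
    · have h3 : ContDiffAt ℝ (⊤ : ℕ∞) (fun y => r y * (q y)⁻¹) y :=
        hrs.contDiffAt.mul (hqs.contDiffAt.inv (hqε y (by linarith)))
      simpa only [hp, div_eq_mul_inv] using h3
  refine ⟨p, hps, ?_, ?_, ?_⟩
  · obtain ⟨C, hC, hCb⟩ := hUd 1 le_rfl
    obtain ⟨B, hB⟩ := (isCompact_Icc (a := -ε) (b := 0)).exists_bound_of_continuousOn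
      hps.continuous.continuousOn
    have hB0 : 0 ≤ B := (norm_nonneg _).trans (hB 0 ⟨by linarith, le_rfl⟩)
    refine ⟨2 * C / δ + B, by positivity, fun y => ?_⟩
    have hE := Real.exp_pos (-η * y)
    rcases le_or_gt 0 y with h | h
    · have h1 : ‖q y‖ * ‖p y‖ = 2 * |deriv U y| := by
        rw [← norm_mul, hqp]
        simp [hr, hχ1 y h]
      have h2 := hCb y h
      rw [iteratedDeriv_one] at h2
      have h3 : Real.exp (-η₀ * y) ≤ Real.exp (-η * y) := Real.exp_le_exp.2 (by nlinarith)
      have h4 : δ * ‖p y‖ ≤ 2 * C * Real.exp (-η * y) := by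
        have := mul_le_mul_of_nonneg_right (hqδ y h) (norm_nonneg (p y))
        nlinarith
      have h5 : ‖p y‖ ≤ 2 * C / δ * Real.exp (-η * y) := by
        rw [div_mul_eq_mul_div, le_div_iff₀ hδ]; linarith
      nlinarith
    · have h1 : 1 ≤ Real.exp (-η * y) := Real.one_le_exp (by nlinarith)
      have h6 : 0 ≤ 2 * C / δ := by positivity
      rcases le_or_gt (-ε) y with h2 | h2
      · have := hB y ⟨h2, h.le⟩
        nlinarith
      · have : p y = 0 := by simp [hp, hr, hχ0 y (by linarith)]
        rw [this, norm_zero]; positivity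
  · have hUk : ∀ k : ℕ, Tendsto (fun y => ((iteratedDeriv (k + 1) U y : ℝ) : ℂ)) atTop (nhds 0) := by
      intro k
      obtain ⟨C, hC, hCb⟩ := hUd (k + 1) (by omega)
      have l0 := tendsto_N (C * η₀) η₀ hη₀
      refine squeeze_zero_norm' ?_ l0
      filter_upwards [eventually_ge_atTop 0] with y hy
      rw [Complex.norm_real, Real.norm_eq_abs]
      refine (hCb y hy).trans (le_of_eq ?_)
      field_simp
    refine p_deriv_tendsto q p r hqs hps hqp δ hδ hqδ ?_ ?_
    · intro k
      refine (hUk k).congr fun y => ?_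
      rw [← congrFun (iter_ofReal U hUs (k + 1)) y, iteratedDeriv_succ', iteratedDeriv_succ']
      congr 1
      funext z
      simp only [hq, deriv_sub_const]
    · intro k
      have := (hUk k).const_mul 2
      rw [mul_zero] at this
      refine this.congr' ?_
      filter_upwards [eventually_gt_atTop 0] with y hy
      have e : r =ᶠ[nhds y] fun z => 2 * ((deriv U z : ℝ) : ℂ) := by
        filter_upwards [Ioi_mem_nhds hy] with z hz
        have hz : 0 < z := hz
        simp [hr, hχ1 z hz.le]
      rw [e.iteratedDeriv_eq k, iteratedDeriv_const_mul_field,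
        congrFun (iter_ofReal (deriv U) hU's k) y, iteratedDeriv_succ']
  · intro y hy
    have := hqp y
    simp only [hr, hχ1 y hy] at this
    simpa using this

theorem rayStar_zero (U : ℝ → ℝ) (α : ℝ) (c : ℂ) (p φ ψ : ℝ → ℂ)
    (hp : ∀ y, 0 ≤ y → ((U y : ℂ) - (starRingEnd ℂ) c) * p y = 2 * ((deriv U y : ℝ) : ℂ))
    (h1 : ∀ y, HasDerivAt φ (ψ y) y) (h2 : ∀ y, HasDerivAt ψ ((α : ℂ) ^ 2 * φ y - p y * ψ y) y)
    (y : ℝ) (hy : 0 ≤ y) : RayStar U α c φ y = 0 := by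
  have d1 : deriv φ = ψ := funext fun y => (h1 y).deriv
  unfold RayStar DeltaA
  rw [d1, (h2 y).deriv, ← hp y hy]
  ring

/-- existence of the slow decaying/growing fundamental solutions of the
adjoint Rayleigh equation, together with the asymptotics of all their derivatives. -/
theorem stmt_6 (U : ℝ → ℝ) (η₀ : ℝ) (hU : ShearFlow U η₀) (α : ℝ) (hα : 0 < α) (c : ℂ)
    (hc : ∃ δ : ℝ, 0 < δ ∧ ∀ y : ℝ, 0 ≤ y → δ ≤ ‖(U y : ℂ) - c‖) :
    ∃ φm φp : ℝ → ℂ, ContDiff ℝ (⊤ : ℕ∞) φm ∧ ContDiff ℝ (⊤ : ℕ∞) φp ∧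
      (∀ y : ℝ, 0 ≤ y → RayStar U α c φm y = 0) ∧
      (∀ y : ℝ, 0 ≤ y → RayStar U α c φp y = 0) ∧
      (∀ n : ℕ, ∃ C : ℂ, C ≠ 0 ∧
        Tendsto (fun y : ℝ => ((Real.exp (α * y) : ℝ) : ℂ) * iteratedDeriv n φm y)
          atTop (nhds C)) ∧
      (∀ n : ℕ, ∃ C : ℂ, C ≠ 0 ∧
        Tendsto (fun y : ℝ => ((Real.exp (-(α * y)) : ℝ) : ℂ) * iteratedDeriv n φp y)
          atTop (nhds C)) := by
  obtain ⟨p, hps, ⟨D, hD, hpD⟩, hpk, hpU⟩ := exists_p U η₀ hU c hc (min η₀ α)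
    (lt_min hU.2.2.2.2.2.2.1 hα) (min_le_left _ _)
  have hη : 0 < min η₀ α := lt_min hU.2.2.2.2.2.2.1 hα
  have hαc : (α : ℂ) ≠ 0 := by exact_mod_cast hα.ne'
  obtain ⟨φm, ψm, m1, m2, Cm, hCm, lm1, lm2⟩ :=
    dec_core α D (min η₀ α) hα hD hη p hps.continuous hpD
  obtain ⟨φp, ψp, p1, p2, Cp, hCp, lp1, lp2⟩ :=
    grow_core α D (min η₀ α) hα hD hη (min_le_right _ _) p hps.continuous hpD
  refine ⟨φm, φp, (smooth_of_system α p φm ψm hps m1 m2).1,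
    (smooth_of_system α p φp ψp hps p1 p2).1, rayStar_zero U α c p φm ψm hpU m1 m2,
    rayStar_zero U α c p φp ψp hpU p1 p2, fun n => ?_, fun n => ?_⟩
  · refine ⟨((-α : ℝ) : ℂ) ^ n * Cm, mul_ne_zero (pow_ne_zero _ (by simpa using hαc)) hCm, ?_⟩
    have := asymp_all α (-α) (by ring) p φm ψm hps hpk m1 m2 Cm lm1 lm2 n
    refine this.congr fun y => ?_
    rw [show -(-α * y) = α * y by ring]
  · exact ⟨(α : ℂ) ^ n * Cp, mul_ne_zero (pow_ne_zero _ hαc) hCp,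
      asymp_all α α rfl p φp ψp hps hpk p1 p2 Cp lp1 lp2 n⟩
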